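/- Let d_v ≥ 4, b = ⌊(d_v+1)/2⌋, and set d = ⌈(d_v-1)/2⌉. Suppose integers d_c, d_T ≥ 2 and p_thr := C(d_v-1, ⌊(d_v-1)/2⌋)^{-1/(d-1)} · d_c^{-d/(d-1)} · d_T^{-1/(d-1)} · (d_T+1)^{-d/(d-1)}. If p_maj ≤ p_thr, p_xor ≤ ((d_T+1)/d_c)·p_thr, and the pre-decoding bit error probability is at most p_reg := p_xor + (d_T+1)·p_thr, then p_maj + C(d_v-1, ⌊(d_v-1)/2⌋) · ((d_c-1)·p_reg + p_xor)^{⌈(d_v-1)/2⌉} ≤ p_maj + (1/d_T)·p_thr. -/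

import Mathlib

theorem rpow_neg_div_pow {x : ℝ} (hx : 0 < x) {k : ℕ} (hk : k ≠ 0) (m : ℕ) :
    (x ^ (-(m : ℝ) / k)) ^ k = (x ^ m)⁻¹ := by
  rw [← Real.rpow_mul_natCast hx.le, div_mul_cancel₀ _ (Nat.cast_ne_zero.mpr hk),
    Real.rpow_neg hx.le, Real.rpow_natCast]


/-- Key error-suppression inequality for one iteration of noisy Gallager-B decoding:
with `d = ⌈(d_v-1)/2⌉`, threshold `p_thr`, `p_maj ≤ p_thr`, `p_xor ≤ ((d_T+1)/d_c) p_thr`,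
and pre-decoding error probability bound `p_reg = p_xor + (d_T+1) p_thr`, one has
`p_maj + C(d_v-1,⌊(d_v-1)/2⌋)((d_c-1) p_reg + p_xor)^d ≤ p_maj + p_thr / d_T`. -/
theorem gallagerB_one_step_suppression (d_v d_c d_T : ℕ) (p_maj p_xor p_thr p_reg : ℝ)
    (hdv : 4 ≤ d_v) (hdc : 2 ≤ d_c) (hdT : 2 ≤ d_T)
    (d : ℕ) (hd : d = (d_v - 1 + 1) / 2)
    (hthr : p_thr
        = ((d_v - 1).choose ((d_v - 1) / 2) : ℝ) ^ (-(1 : ℝ) / ((d : ℝ) - 1))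
          * (d_c : ℝ) ^ (-(d : ℝ) / ((d : ℝ) - 1))
          * (d_T : ℝ) ^ (-(1 : ℝ) / ((d : ℝ) - 1))
          * ((d_T : ℝ) + 1) ^ (-(d : ℝ) / ((d : ℝ) - 1)))
    (hxor0 : 0 ≤ p_xor)
    (hmaj : p_maj ≤ p_thr)
    (hxor : p_xor ≤ (((d_T : ℝ) + 1) / (d_c : ℝ)) * p_thr)
    (hreg : p_reg = p_xor + ((d_T : ℝ) + 1) * p_thr) :
    p_maj + ((d_v - 1).choose ((d_v - 1) / 2) : ℝ)
        * (((d_c : ℝ) - 1) * p_reg + p_xor) ^ d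
      ≤ p_maj + (1 / (d_T : ℝ)) * p_thr := by
  obtain ⟨k, rfl⟩ : ∃ k, d = k + 1 := ⟨d - 1, by omega⟩
  have hk : k ≠ 0 := by omega
  have hC : (0 : ℝ) < ((d_v - 1).choose ((d_v - 1) / 2) : ℝ) := by
    exact_mod_cast Nat.choose_pos (Nat.div_le_self _ _)
  generalize ((d_v - 1).choose ((d_v - 1) / 2) : ℝ) = C at *
  have hc : (2 : ℝ) ≤ d_c := by exact_mod_cast hdc
  have hT : (0 : ℝ) < d_T := by exact_mod_cast (by omega : 0 < d_T)
  have hc0 : (0 : ℝ) < d_c := by linarith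
  have hT1 : (0 : ℝ) < (d_T : ℝ) + 1 := by linarith
  have hpos : 0 < p_thr := by rw [hthr]; positivity
  have hsub : ((k + 1 : ℕ) : ℝ) - 1 = k := by push_cast; ring
  have hpow : p_thr ^ k
      = C⁻¹ * ((d_c : ℝ) ^ (k + 1))⁻¹ * (d_T : ℝ)⁻¹ * (((d_T : ℝ) + 1) ^ (k + 1))⁻¹ := by
    have hone : ∀ {x : ℝ}, 0 < x → (x ^ (-(1 : ℝ) / k)) ^ k = x⁻¹ := fun {x} hx => by
      simpa using rpow_neg_div_pow hx hk 1
    rw [hthr, hsub, mul_pow, mul_pow, mul_pow, hone hC, hone hT,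
      rpow_neg_div_pow hc0 hk, rpow_neg_div_pow hT1 hk]
  have hbase : ((d_c : ℝ) - 1) * p_reg + p_xor ≤ d_c * ((d_T : ℝ) + 1) * p_thr := by
    have h : d_c * p_xor ≤ ((d_T : ℝ) + 1) * p_thr :=
      calc d_c * p_xor ≤ d_c * (((d_T : ℝ) + 1) / d_c * p_thr) := by gcongr
        _ = ((d_T : ℝ) + 1) * p_thr := by field_simp
    rw [hreg]
    linarith
  have hbase0 : 0 ≤ ((d_c : ℝ) - 1) * p_reg + p_xor := by
    have : 0 ≤ (d_c : ℝ) - 1 := by linarith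
    rw [hreg]
    positivity
  have hle : C * (((d_c : ℝ) - 1) * p_reg + p_xor) ^ (k + 1) ≤ 1 / (d_T : ℝ) * p_thr :=
    calc C * (((d_c : ℝ) - 1) * p_reg + p_xor) ^ (k + 1)
        ≤ C * (d_c * ((d_T : ℝ) + 1) * p_thr) ^ (k + 1) := by gcongr
      _ = C * (d_c : ℝ) ^ (k + 1) * ((d_T : ℝ) + 1) ^ (k + 1) * p_thr ^ k * p_thr := by
        rw [mul_pow, mul_pow, pow_succ p_thr]
        ring
      _ = 1 / (d_T : ℝ) * p_thr := by rw [hpow]; field_simp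
  linarith
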